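/- arXiv:2301.09166 — 2 statements merged into one kernel-verified Lean document; each statement's English description precedes it below -/
import Mathlib

section
/- Let s be a fixed objective index and let ε_i ∈ ℝ for each i ≠ s. If x* is the unique minimizer of f_s over the constrained feasible set {x ∈ S : f_i(x) ≤ ε_i for all i ≠ s}, then x* is Pareto optimal for (f_1, …, f_I) on S. -/
/-- ε-Constraint Method: the unique minimizer of `f s` over the
ε-constrained feasible set is Pareto optimal on `S`. -/
theorem epsConstraint_unique_minimizer_pareto
    {X : Type*} (S : Set X) (I : ℕ) (f : Fin I → X → ℝ) (s : Fin I)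
    (ε : Fin I → ℝ) (xstar : X) (hxstar : xstar ∈ S)
    (hfeas : ∀ i, i ≠ s → f i xstar ≤ ε i)
    (hmin : ∀ x ∈ S, (∀ i, i ≠ s → f i x ≤ ε i) → f s xstar ≤ f s x)
    (huniq : ∀ y ∈ S, (∀ i, i ≠ s → f i y ≤ ε i) → f s y = f s xstar → y = xstar) :
    ¬ ∃ x ∈ S, (∀ i, f i x ≤ f i xstar) ∧ ∃ j, f j x < f j xstar := by
  rintro ⟨x, hxS, hle, j, hj⟩
  have hx : ∀ i, i ≠ s → f i x ≤ ε i := fun i hi => (hle i).trans (hfeas i hi)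
  have heq : x = xstar := huniq x hxS hx (le_antisymm (hle s) (hmin x hxS hx))
  rw [heq] at hj
  exact lt_irrefl _ hj
end

section
/- Let z ∈ ℝ^I satisfy z_i ≤ f_i(x) for every x ∈ S and every i, and let w_i > 0 for all i. If x* minimizes the weighted Chebyshev criterion x ↦ max_{1 ≤ i ≤ I} w_i · (f_i(x) − z_i) over the feasible set S, then x* is weakly Pareto optimal for (f_1, …, f_I) on S. -/
/-- Weighted Chebyshev (global criterion with `p → ∞`): a minimizer of the
weighted maximum deviation from a utopia point `z` with positive weights is
weakly Pareto optimal. -/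
theorem chebyshev_weakPareto
    {X : Type*} (S : Set X) (I : ℕ) (hI : 0 < I)
    (f : Fin I → X → ℝ) (z : Fin I → ℝ)
    (hz : ∀ x ∈ S, ∀ i, z i ≤ f i x) (w : Fin I → ℝ) (hw : ∀ i, 0 < w i)
    (xstar : X) (hxstar : xstar ∈ S)
    (hmin : ∀ x ∈ S,
      (Finset.univ.sup' ⟨⟨0, hI⟩, Finset.mem_univ _⟩ fun i => w i * (f i xstar - z i)) ≤
        Finset.univ.sup' ⟨⟨0, hI⟩, Finset.mem_univ _⟩ fun i => w i * (f i x - z i)) :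
    ¬ ∃ x ∈ S, ∀ i, f i x < f i xstar := by
  rintro ⟨x, hx, hlt⟩
  refine absurd (hmin x hx) (not_le.mpr ?_)
  refine (Finset.sup'_lt_iff _).mpr ?_
  intro i _
  have h1 : w i * (f i x - z i) < w i * (f i xstar - z i) :=
    mul_lt_mul_of_pos_left (sub_lt_sub_right (hlt i) _) (hw i)
  exact lt_of_lt_of_le h1
    (Finset.le_sup' (fun i => w i * (f i xstar - z i)) (Finset.mem_univ i))
end
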